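/- arXiv:2307.07884 — 3 statements merged into one kernel-verified Lean document; each statement's English description precedes it below -/
import Mathlib

section
/- Let M, M̃ ∈ ℝ^{n×n} be symmetric positive definite matrices, and let U ∈ ℝ^{n×n} be an invertible matrix and λ_1,…,λ_n > 0 be such that UᵀM̃U = I_n and UᵀMU = diag(λ_1,…,λ_n) (such U and λ_i always exist and the λ_i are the generalized eigenvalues of the pair (M,M̃)). Then (1/κ(M)) · ‖M−M̃‖_F/‖M‖_F ≤ sqrt( (1/n) Σ_{i=1}^n (1 − 1/λ_i)² ) ≤ κ(M) · ‖M−M̃‖_F/‖M‖_F, where κ(M) = λ_max(M)/λ_min(M) is the spectral condition number of M. -/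
open Matrix

/-- Frobenius norm: `‖A‖_F = trace(Aᵀ A)^{1/2}`. -/
noncomputable def frobNorm {m n : Type*} [Fintype m] [Fintype n]
    (A : Matrix m n ℝ) : ℝ := Real.sqrt (Matrix.trace (Aᵀ * A))

/-- Spectral condition number of a symmetric positive definite matrix:
`κ(M) = λ_max(M) / λ_min(M)`. -/
noncomputable def specCond {n : ℕ} {M : Matrix (Fin n) (Fin n) ℝ}
    (hM : M.PosDef) : ℝ :=
  (⨆ i, hM.isHermitian.eigenvalues i) / (⨅ i, hM.isHermitian.eigenvalues i)

theorem Matrix.PosDef.exists_orthogonal_diagonalization {n : ℕ} {M : Matrix (Fin n) (Fin n) ℝ}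
    (hM : M.PosDef) : ∃ Q : Matrix (Fin n) (Fin n) ℝ, Qᵀ * Q = 1 ∧ Q * Qᵀ = 1 ∧
      M = Q * diagonal hM.isHermitian.eigenvalues * Qᵀ := by
  have hQ := hM.isHermitian.eigenvectorUnitary.2
  refine ⟨hM.isHermitian.eigenvectorUnitary, ?_, ?_, ?_⟩
  · simpa [star_eq_conjTranspose] using (mem_unitaryGroup_iff'.1 hQ)
  · simpa [star_eq_conjTranspose] using (mem_unitaryGroup_iff.1 hQ)
  · have h := hM.isHermitian.spectral_theorem
    rw [Unitary.conjStarAlgAut_apply] at h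
    simpa [star_eq_conjTranspose, Function.comp_def] using h

theorem trace_transpose_mul_self_eq_sum {n : ℕ} (B : Matrix (Fin n) (Fin n) ℝ) :
    (Bᵀ * B).trace = ∑ i, ∑ j, B i j ^ 2 := by
  rw [Finset.sum_comm]
  simp [trace, mul_apply, sq]

theorem trace_transpose_mul_self_conj {n : ℕ} {Q : Matrix (Fin n) (Fin n) ℝ}
    (hQ : Qᵀ * Q = 1) (B : Matrix (Fin n) (Fin n) ℝ) :
    ((Q * B * Qᵀ)ᵀ * (Q * B * Qᵀ)).trace = (Bᵀ * B).trace := by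
  have h : (Q * B * Qᵀ)ᵀ * (Q * B * Qᵀ) = Q * (Bᵀ * (Qᵀ * Q) * B * Qᵀ) := by
    simp only [transpose_mul, transpose_transpose, Matrix.mul_assoc]
  rw [h, hQ, trace_mul_comm, Matrix.mul_one, Matrix.mul_assoc _ Qᵀ Q, hQ, Matrix.mul_one]

theorem trace_mul_diagonal_mul_diagonal {n : ℕ} {B : Matrix (Fin n) (Fin n) ℝ} (hB : Bᵀ = B)
    (d : Fin n → ℝ) :
    (B * diagonal d * B * diagonal d).trace = ∑ i, ∑ j, B i j ^ 2 * (d i * d j) := by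
  have hs : ∀ i j, B j i = B i j := fun i j => congrFun (congrFun hB i) j
  simp only [trace, diag_apply, mul_diagonal]
  refine Finset.sum_congr rfl fun i _ => ?_
  rw [mul_apply, Finset.sum_mul]
  refine Finset.sum_congr rfl fun j _ => ?_
  rw [mul_diagonal, hs i j]
  ring

/-- If `U` simultaneously diagonalizes `M` and `Mt`, then `M⁻¹ = U * diagonal lam⁻¹ * Uᵀ`, and the
sum of the squared relative deviations is `trace ((M - Mt) * M⁻¹ * (M - Mt) * M⁻¹)`. -/
theorem sum_one_sub_inv_sq_eq_trace {n : ℕ} {M Mt U P : Matrix (Fin n) (Fin n) ℝ}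
    (hU : IsUnit U.det) {lam : Fin n → ℝ} (hlam : ∀ i, 0 < lam i)
    (h1 : Uᵀ * Mt * U = 1) (h2 : Uᵀ * M * U = diagonal lam) (hP : M * P = 1) :
    ∑ i, (1 - 1 / lam i) ^ 2 = ((M - Mt) * P * (M - Mt) * P).trace := by
  have hD : diagonal (fun i => (lam i)⁻¹) * diagonal lam = 1 := by
    rw [diagonal_mul_diagonal, ← diagonal_one]
    congr 1; ext i; exact inv_mul_cancel₀ (hlam i).ne'
  have hinv : U * diagonal (fun i => (lam i)⁻¹) * Uᵀ * M = 1 := by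
    have h : U * diagonal (fun i => (lam i)⁻¹) * Uᵀ * M * U = U := by
      calc _ = U * (diagonal (fun i => (lam i)⁻¹) * (Uᵀ * M * U)) := by
            simp only [Matrix.mul_assoc]
        _ = U := by rw [h2, hD, Matrix.mul_one]
    calc _ = U * diagonal (fun i => (lam i)⁻¹) * Uᵀ * M * U * U⁻¹ := by
          rw [Matrix.mul_assoc _ U, mul_nonsing_inv _ hU, Matrix.mul_one]
      _ = 1 := by rw [h, mul_nonsing_inv _ hU]
  have hPU : U * diagonal (fun i => (lam i)⁻¹) * Uᵀ = P := left_inv_eq_right_inv hinv hP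
  have hA : Uᵀ * (M - Mt) * U = diagonal (fun i => lam i - 1) := by
    rw [Matrix.mul_sub, Matrix.sub_mul, h1, h2, ← diagonal_one, diagonal_sub]
  have key : ((M - Mt) * P * (M - Mt) * P).trace =
      ((Uᵀ * (M - Mt) * U) * diagonal (fun i => (lam i)⁻¹) *
        (Uᵀ * (M - Mt) * U) * diagonal (fun i => (lam i)⁻¹)).trace := by
    rw [← hPU]
    simp only [← Matrix.mul_assoc]
    rw [trace_mul_comm]
    simp only [← Matrix.mul_assoc]
  rw [key, hA, diagonal_mul_diagonal, diagonal_mul_diagonal, diagonal_mul_diagonal, trace_diagonal]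
  refine Finset.sum_congr rfl fun i _ => ?_
  have := (hlam i).ne'
  field_simp

theorem stmt0 {n : ℕ} (M Mt U : Matrix (Fin n) (Fin n) ℝ)
    (hM : M.PosDef) (hMt : Mt.PosDef) (hU : IsUnit U.det)
    (lam : Fin n → ℝ) (hlam : ∀ i, 0 < lam i)
    (h1 : Uᵀ * Mt * U = 1) (h2 : Uᵀ * M * U = Matrix.diagonal lam) :
    (1 / specCond hM) * (frobNorm (M - Mt) / frobNorm M) ≤
        Real.sqrt ((1 / (n : ℝ)) * ∑ i, (1 - 1 / lam i) ^ 2) ∧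
      Real.sqrt ((1 / (n : ℝ)) * ∑ i, (1 - 1 / lam i) ^ 2) ≤
        specCond hM * (frobNorm (M - Mt) / frobNorm M) := by
  rcases Nat.eq_zero_or_pos n with rfl | hn
  · simp [specCond]
  have : Nonempty (Fin n) := ⟨⟨0, hn⟩⟩
  obtain ⟨Q, hQ, hQ', hMQ⟩ := hM.exists_orthogonal_diagonalization
  unfold specCond
  set μ := hM.isHermitian.eigenvalues
  have hμpos : ∀ i, 0 < μ i := hM.eigenvalues_pos
  set a := ⨅ i, μ i with ha
  set b := ⨆ i, μ i
  have hle : ∀ i, a ≤ μ i := ciInf_le (Set.finite_range μ).bddBelow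
  have hge : ∀ i, μ i ≤ b := le_ciSup (Set.finite_range μ).bddAbove
  have hapos : 0 < a := by
    obtain ⟨i, hi⟩ := exists_eq_ciInf_of_finite (f := μ)
    rw [ha, ← hi]; exact hμpos i
  have hbpos : 0 < b := hapos.trans_le ((hle ⟨0, hn⟩).trans (hge _))
  have hP : M * (Q * diagonal (fun i => (μ i)⁻¹) * Qᵀ) = 1 := by
    calc _ = Q * (diagonal μ * (Qᵀ * Q) * diagonal (fun i => (μ i)⁻¹)) * Qᵀ := by
          conv_lhs => rw [hMQ]
          simp only [Matrix.mul_assoc]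
      _ = 1 := by
          have : (fun i => μ i * (μ i)⁻¹) = fun _ => 1 :=
            funext fun i => mul_inv_cancel₀ (hμpos i).ne'
          rw [hQ, Matrix.mul_one, diagonal_mul_diagonal, this, diagonal_one, Matrix.mul_one, hQ']
  have hMs : Mᵀ = M := by simpa using hM.isHermitian.eq
  have hMts : Mtᵀ = Mt := by simpa using hMt.isHermitian.eq
  set B := Qᵀ * (M - Mt) * Q with hBdef
  have hB : Bᵀ = B := by
    rw [hBdef]
    simp only [transpose_mul, transpose_transpose, transpose_sub, hMs, hMts, Matrix.mul_assoc]
  have hA : M - Mt = Q * B * Qᵀ := by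
    calc M - Mt = (Q * Qᵀ) * (M - Mt) * (Q * Qᵀ) := by simp [hQ']
      _ = _ := by simp only [hBdef, Matrix.mul_assoc]
  have hS : ∑ i, (1 - 1 / lam i) ^ 2 = ∑ i, ∑ j, B i j ^ 2 * ((μ i)⁻¹ * (μ j)⁻¹) := by
    rw [sum_one_sub_inv_sq_eq_trace hU hlam h1 h2 hP, ← trace_mul_diagonal_mul_diagonal hB]
    simp only [← Matrix.mul_assoc]
    rw [trace_mul_comm]
    simp only [hBdef, ← Matrix.mul_assoc]
  have hN : ((M - Mt)ᵀ * (M - Mt)).trace = ∑ i, ∑ j, B i j ^ 2 := by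
    rw [hA, trace_transpose_mul_self_conj hQ, trace_transpose_mul_self_eq_sum]
  have hK : (Mᵀ * M).trace = ∑ i, μ i ^ 2 := by
    conv_lhs => rw [hMQ]
    rw [trace_transpose_mul_self_conj hQ]
    simp [sq]
  have hn' : (0 : ℝ) < n := Nat.cast_pos.2 hn
  set S := ∑ i, (1 - 1 / lam i) ^ 2
  set N := ((M - Mt)ᵀ * (M - Mt)).trace
  set K := (Mᵀ * M).trace
  have hN0 : 0 ≤ N := by rw [hN]; positivity
  have hS_ge : N / b ^ 2 ≤ S := by
    rw [hS, hN, Finset.sum_div]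
    refine Finset.sum_le_sum fun i _ => ?_
    rw [Finset.sum_div]
    refine Finset.sum_le_sum fun j _ => ?_
    rw [div_eq_mul_inv, sq b, mul_inv]
    have := hμpos i
    have := hμpos j
    gcongr
    · exact hge i
    · exact hge j
  have hS_le : S ≤ N / a ^ 2 := by
    rw [hS, hN, Finset.sum_div]
    refine Finset.sum_le_sum fun i _ => ?_
    rw [Finset.sum_div]
    refine Finset.sum_le_sum fun j _ => ?_
    rw [div_eq_mul_inv, sq a, mul_inv]
    have := hμpos i
    have := hμpos j
    gcongr
    · exact hle i
    · exact hle j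
  have hK_ge : n * a ^ 2 ≤ K := by
    rw [hK]
    calc (n : ℝ) * a ^ 2 = ∑ _i : Fin n, a ^ 2 := by simp
      _ ≤ _ := Finset.sum_le_sum fun i _ => pow_le_pow_left₀ hapos.le (hle i) 2
  have hK_le : K ≤ n * b ^ 2 := by
    rw [hK]
    calc _ ≤ ∑ _i : Fin n, b ^ 2 :=
          Finset.sum_le_sum fun i _ => pow_le_pow_left₀ (hμpos i).le (hge i) 2
      _ = _ := by simp
  have hKpos : 0 < K := lt_of_lt_of_le (by positivity) hK_ge
  have hfrob : frobNorm (M - Mt) / frobNorm M = √(N / K) := (Real.sqrt_div hN0 K).symm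
  rw [hfrob]
  constructor
  · apply Real.le_sqrt_of_sq_le
    rw [mul_pow, Real.sq_sqrt (by positivity)]
    calc (1 / (b / a)) ^ 2 * (N / K) = a ^ 2 * (N / b ^ 2) / K := by field_simp
      _ ≤ a ^ 2 * S / (n * a ^ 2) := by gcongr
      _ = 1 / n * S := by field_simp
  · apply Real.sqrt_le_iff.2 ⟨by positivity, ?_⟩
    rw [mul_pow, Real.sq_sqrt (by positivity)]
    calc 1 / n * S ≤ 1 / n * (N / a ^ 2) := by gcongr
      _ = b ^ 2 * (N / a ^ 2) / (n * b ^ 2) := by field_simp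
      _ ≤ b ^ 2 * (N / a ^ 2) / K := by gcongr
      _ = (b / a) ^ 2 * (N / K) := by field_simp
end

section
/- Let A_1,…,A_r ∈ ℝ^{n×n}, B_1,…,B_r ∈ ℝ^{m×m}, and let Z ∈ ℝ^{m×m} with Z ≠ 0. Then Y* = Σ_{k=1}^r (⟨B_k, Z⟩_F / ⟨Z, Z⟩_F) A_k minimizes the map Y ↦ ‖Σ_{k=1}^r A_k ⊗ B_k − Y ⊗ Z‖_F over all Y ∈ ℝ^{n×n}. -/
open Matrix
open scoped Kronecker

/-- Frobenius inner product: `⟨A,B⟩_F = trace(Aᵀ B)`. -/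
noncomputable def frobInner {m n : Type*} [Fintype m] [Fintype n]
    (A B : Matrix m n ℝ) : ℝ := Matrix.trace (Aᵀ * B)

theorem frobInner_self_nonneg {p q : Type*} [Fintype p] [Fintype q] (P : Matrix p q ℝ) :
    0 ≤ frobInner P P := by
  simp only [frobInner, trace, diag_apply, mul_apply, transpose_apply]
  exact Finset.sum_nonneg fun i _ => Finset.sum_nonneg fun j _ => mul_self_nonneg _

theorem frobInner_self_ne_zero {p q : Type*} [Fintype p] [Fintype q] {P : Matrix p q ℝ}
    (hP : P ≠ 0) : frobInner P P ≠ 0 := by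
  intro h
  refine hP (trace_conjTranspose_mul_self_eq_zero_iff.mp ?_)
  rwa [conjTranspose_eq_transpose_of_trivial]

theorem frobInner_comm {p q : Type*} [Fintype p] [Fintype q] (P Q : Matrix p q ℝ) :
    frobInner P Q = frobInner Q P := by
  rw [frobInner, frobInner, ← trace_transpose, transpose_mul, transpose_transpose]

theorem frobInner_kronecker {p q s t : Type*} [Fintype p] [Fintype q] [Fintype s] [Fintype t]
    (A C : Matrix p q ℝ) (B D : Matrix s t ℝ) :
    frobInner (A ⊗ₖ B) (C ⊗ₖ D) = frobInner A C * frobInner B D := by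
  simp only [frobInner, ← trace_kronecker, mul_kronecker_mul, kroneckerMap_transpose]

/-- Adding a Frobenius-orthogonal matrix does not decrease the Frobenius norm. -/
theorem frobNorm_le_frobNorm_add {p q : Type*} [Fintype p] [Fintype q] {P R : Matrix p q ℝ}
    (h : frobInner P R = 0) : frobNorm R ≤ frobNorm (R + P) := by
  have h' : frobInner R P = 0 := by rw [frobInner_comm, h]
  have hP := frobInner_self_nonneg P
  unfold frobInner at h h' hP
  refine Real.sqrt_le_sqrt ?_
  simp only [transpose_add, Matrix.add_mul, Matrix.mul_add, trace_add]
  linarith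

/-- The residual of the Kronecker approximation is orthogonal to every `W ⊗ Z`. -/
theorem frobInner_kronecker_residual {ι p q s t : Type*} [Fintype ι] [Fintype p] [Fintype q]
    [Fintype s] [Fintype t] (A : ι → Matrix p q ℝ) (B : ι → Matrix s t ℝ) {Z : Matrix s t ℝ}
    (hZ : Z ≠ 0) (W : Matrix p q ℝ) :
    frobInner (W ⊗ₖ Z) ((∑ k, A k ⊗ₖ B k) -
      (∑ k, (frobInner (B k) Z / frobInner Z Z) • A k) ⊗ₖ Z) = 0 := by
  have hsub (U V : Matrix (p × s) (q × t) ℝ) :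
      frobInner (W ⊗ₖ Z) (U - V) = frobInner (W ⊗ₖ Z) U - frobInner (W ⊗ₖ Z) V := by
    simp only [frobInner, Matrix.mul_sub, trace_sub]
  have hsum : frobInner (W ⊗ₖ Z) (∑ k, A k ⊗ₖ B k) =
      ∑ k, frobInner (W ⊗ₖ Z) (A k ⊗ₖ B k) := by
    simp only [frobInner, Matrix.mul_sum, trace_sum]
  have hproj : frobInner W (∑ k, (frobInner (B k) Z / frobInner Z Z) • A k) =
      ∑ k, frobInner (B k) Z / frobInner Z Z * frobInner W (A k) := by
    simp only [frobInner, Matrix.mul_sum, trace_sum, Matrix.mul_smul, trace_smul, smul_eq_mul]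
  have hZZ := frobInner_self_ne_zero hZ
  rw [hsub, hsum, frobInner_kronecker, hproj, Finset.sum_mul, sub_eq_zero]
  refine Finset.sum_congr rfl fun k _ => ?_
  rw [frobInner_kronecker, frobInner_comm Z (B k)]
  field_simp

theorem stmt9 {n m r : ℕ} (A : Fin r → Matrix (Fin n) (Fin n) ℝ)
    (B : Fin r → Matrix (Fin m) (Fin m) ℝ)
    (Z : Matrix (Fin m) (Fin m) ℝ) (hZ : Z ≠ 0) :
    ∀ Y : Matrix (Fin n) (Fin n) ℝ,
      frobNorm ((∑ k, A k ⊗ₖ B k) -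
          (∑ k, (frobInner (B k) Z / frobInner Z Z) • A k) ⊗ₖ Z) ≤
        frobNorm ((∑ k, A k ⊗ₖ B k) - Y ⊗ₖ Z) := by
  intro Y
  have hsplit : (∑ k, A k ⊗ₖ B k) - Y ⊗ₖ Z =
      ((∑ k, A k ⊗ₖ B k) - (∑ k, (frobInner (B k) Z / frobInner Z Z) • A k) ⊗ₖ Z) +
        ((∑ k, (frobInner (B k) Z / frobInner Z Z) • A k) - Y) ⊗ₖ Z := by
    ext ⟨i, j⟩ ⟨i', j'⟩
    simp only [Matrix.add_apply, Matrix.sub_apply, kroneckerMap_apply]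
    ring
  rw [hsplit]
  exact frobNorm_le_frobNorm_add (frobInner_kronecker_residual A B hZ _)
end

section
/- Let A_1,…,A_r, C_1,…,C_q ∈ ℝ^{n×n} and B_1,…,B_r, D_1,…,D_q ∈ ℝ^{m×m}. Then ‖I_{nm} − Σ_{s=1}^q Σ_{k=1}^r A_k C_s ⊗ B_k D_s‖_F² = nm − 2 Σ_{k=1}^r Σ_{s=1}^q γ_k^s δ_k^s + Σ_{k,l=1}^r Σ_{s,t=1}^q α_{kl}^{st} β_{kl}^{st}, where γ_k^s = ⟨B_kᵀ, D_s⟩_F, δ_k^s = ⟨A_kᵀ, C_s⟩_F, α_{kl}^{st} = ⟨B_kᵀB_l, D_s D_tᵀ⟩_F and β_{kl}^{st} = ⟨A_kᵀA_l, C_s C_tᵀ⟩_F. -/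
open Matrix
open scoped Kronecker

theorem frobNorm_sq {m n : Type*} [Fintype m] [Fintype n] (M : Matrix m n ℝ) :
    frobNorm M ^ 2 = Matrix.trace (Mᵀ * M) := by
  refine Real.sq_sqrt ?_
  simp only [Matrix.trace, Matrix.diag_apply, Matrix.mul_apply, Matrix.transpose_apply]
  exact Finset.sum_nonneg fun i _ => Finset.sum_nonneg fun j _ => mul_self_nonneg _

theorem frobNorm_one_sub_sq {ι : Type*} [Fintype ι] [DecidableEq ι] (M : Matrix ι ι ℝ) :
    frobNorm (1 - M) ^ 2 =
      (Fintype.card ι : ℝ) - 2 * Matrix.trace M + Matrix.trace (Mᵀ * M) := by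
  rw [frobNorm_sq]
  simp only [Matrix.transpose_sub, Matrix.transpose_one, sub_mul, mul_sub, one_mul, mul_one,
    Matrix.trace_sub, Matrix.trace_one, Matrix.trace_transpose]
  ring

theorem frobInner_transpose_mul_mul_transpose {n : Type*} [Fintype n]
    (A A' C C' : Matrix n n ℝ) :
    frobInner (Aᵀ * A') (C * C'ᵀ) = Matrix.trace ((A * C)ᵀ * (A' * C')) := by
  rw [frobInner, ← Matrix.trace_transpose ((A * C)ᵀ * (A' * C'))]
  simp only [Matrix.transpose_mul, Matrix.transpose_transpose, Matrix.mul_assoc]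
  rw [Matrix.trace_mul_comm C'ᵀ]
  simp only [Matrix.mul_assoc]

theorem trace_transpose_mul_kronecker {m n : Type*} [Fintype m] [Fintype n]
    (X X' : Matrix n n ℝ) (Y Y' : Matrix m m ℝ) :
    Matrix.trace ((X ⊗ₖ Y)ᵀ * (X' ⊗ₖ Y')) =
      Matrix.trace (Yᵀ * Y') * Matrix.trace (Xᵀ * X') := by
  rw [← Matrix.kroneckerMap_transpose, ← Matrix.mul_kronecker_mul, Matrix.trace_kronecker,
    mul_comm]

/-- `γ_k^s = ⟨B_kᵀ, D_s⟩_F`, `δ_k^s = ⟨A_kᵀ, C_s⟩_F`,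
`α_{kl}^{st} = ⟨B_kᵀB_l, D_s D_tᵀ⟩_F`, `β_{kl}^{st} = ⟨A_kᵀA_l, C_s C_tᵀ⟩_F`. -/
theorem stmt17 {n m r q : ℕ}
    (A : Fin r → Matrix (Fin n) (Fin n) ℝ) (C : Fin q → Matrix (Fin n) (Fin n) ℝ)
    (B : Fin r → Matrix (Fin m) (Fin m) ℝ) (D : Fin q → Matrix (Fin m) (Fin m) ℝ) :
    frobNorm ((1 : Matrix (Fin n × Fin m) (Fin n × Fin m) ℝ) -
        ∑ s, ∑ k, (A k * C s) ⊗ₖ (B k * D s)) ^ 2 =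
      (n : ℝ) * m -
        2 * (∑ k, ∑ s, frobInner (B k)ᵀ (D s) * frobInner (A k)ᵀ (C s)) +
        ∑ k, ∑ l, ∑ s, ∑ t, frobInner ((B k)ᵀ * B l) (D s * (D t)ᵀ) *
          frobInner ((A k)ᵀ * A l) (C s * (C t)ᵀ) := by
  simp only [frobInner_transpose_mul_mul_transpose]
  rw [Finset.sum_comm, frobNorm_one_sub_sq]
  congr 1
  · simp [frobInner, Matrix.trace_sum, Matrix.trace_kronecker, mul_comm]
  · simp only [Matrix.transpose_sum, Finset.sum_mul, Finset.mul_sum, Matrix.trace_sum,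
      trace_transpose_mul_kronecker]
    refine Eq.trans (Finset.sum_congr rfl fun l _ => ?_) Finset.sum_comm
    refine Finset.sum_comm.trans (Finset.sum_congr rfl fun k _ => ?_)
    exact Finset.sum_comm
end
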